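/- Let p be a prime, F = 𝔽_p, F̄ an algebraic closure of F, and G a finite group. For every finite-dimensional indecomposable F̄G-module Y there exist a finite subfield K of F̄, an indecomposable FG-module W, and an indecomposable KG-module V such that V | W ⊗_F K and V ⊗_K F̄ ≅ Y as F̄G-modules. (This is the totality of the map Γ : ITI(F̄G) → ITI(FG).) -/

import Mathlib

set_option synthInstance.maxHeartbeats 1600000
set_option maxHeartbeats 1600000

open TensorProduct

/-- Base change of a representation along a (commutative) algebra `k → L`:
the `L`-linear representation of `G` on `V ⊗_k L = L ⊗[k] V`. -/
noncomputable def repBaseChange {k : Type*} [CommRing k] (L : Type*) [CommRing L] [Algebra k L]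
    {G : Type*} [Monoid G] {V : Type*} [AddCommGroup V] [Module k V]
    (ρ : Representation k G V) : Representation L G (L ⊗[k] V) :=
  (Module.End.baseChangeHom k L V).toRingHom.toMonoidHom.comp ρ

/-- Restriction of scalars `Res_K` of a representation along `K ⊆ L`. -/
def repRes (K : Type*) {L : Type*} [CommRing K] [CommRing L] [Algebra K L]
    {G : Type*} [Monoid G] {U : Type*} [AddCommGroup U] [Module K U] [Module L U]
    [IsScalarTower K L U] (ρ : Representation L G U) : Representation K G U where
  toFun g := (ρ g).restrictScalars K
  map_one' := by ext u; simp
  map_mul' g h := by ext u; simp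

/-- Two representations of `G` over `k` are isomorphic iff the corresponding modules over the
group algebra `MonoidAlgebra k G` are linearly equivalent. -/
def RepIso {k : Type*} [CommSemiring k] {G : Type*} [Monoid G]
    {V W : Type*} [AddCommMonoid V] [Module k V] [AddCommMonoid W] [Module k W]
    (ρ : Representation k G V) (τ : Representation k G W) : Prop :=
  Nonempty (ρ.asModule ≃ₗ[MonoidAlgebra k G] τ.asModule)

/-- `ρ | τ` : `ρ` is (isomorphic to) a direct summand of `τ`, i.e. `τ` is the internal direct
sum of two submodules (over the group algebra `MonoidAlgebra k G`), the first of which is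
isomorphic to `ρ`. -/
def RepSummand {k : Type*} [CommSemiring k] {G : Type*} [Monoid G]
    {V W : Type*} [AddCommMonoid V] [Module k V] [AddCommMonoid W] [Module k W]
    (ρ : Representation k G V) (τ : Representation k G W) : Prop :=
  ∃ A B : Submodule (MonoidAlgebra k G) τ.asModule,
    IsCompl A B ∧ Nonempty (ρ.asModule ≃ₗ[MonoidAlgebra k G] A)

/-- A representation is indecomposable if it is nonzero and the corresponding module over the
group algebra is not the internal direct sum of two nonzero submodules. -/
def RepIndecomposable {k : Type*} [CommSemiring k] {G : Type*} [Monoid G]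
    {V : Type*} [AddCommMonoid V] [Module k V] (ρ : Representation k G V) : Prop :=
  Nontrivial V ∧
    ∀ A B : Submodule (MonoidAlgebra k G) ρ.asModule, IsCompl A B → A = ⊥ ∨ B = ⊥

/-- A representation is simple if the corresponding module over the group algebra is simple. -/
def RepSimple {k : Type*} [CommRing k] {G : Type*} [Monoid G]
    {V : Type*} [AddCommGroup V] [Module k V] (ρ : Representation k G V) : Prop :=
  IsSimpleModule (MonoidAlgebra k G) ρ.asModule

universe u

section Indecomposable

variable {k : Type*} [Field k] {G : Type*} [Monoid G]
  {V : Type*} [AddCommGroup V] [Module k V] {W : Type*} [AddCommGroup W] [Module k W]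

/-- Indecomposability in terms of equivariant idempotent endomorphisms. -/
theorem repIndecomposable_iff_idempotent (ρ : Representation k G V) :
    RepIndecomposable ρ ↔ Nontrivial V ∧ ∀ e : ρ.IntertwiningMap ρ,
      IsIdempotentElem e → e = 0 ∨ e = 1 := by
  refine and_congr_right fun _ => ⟨fun h e he => ?_, fun h A B hAB => ?_⟩
  · have hE : IsIdempotentElem (Representation.IntertwiningMap.equivAlgEnd ρ e) :=
      he.map (Representation.IntertwiningMap.equivAlgEnd ρ)
    rcases h _ _ (LinearMap.IsIdempotentElem.isCompl hE) with h0 | h0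
    · left
      have h1 := LinearMap.range_eq_bot.1 h0
      exact (map_eq_zero_iff _ (Representation.IntertwiningMap.equivAlgEnd ρ).injective).1 h1
    · right
      have h1 : Function.Injective (Representation.IntertwiningMap.equivAlgEnd ρ e) :=
        LinearMap.ker_eq_bot.1 h0
      ext v
      exact h1 congr($he v)
  · set f := A.projection B hAB with hf
    have hfi : IsIdempotentElem f := Submodule.isIdempotentElem_projection hAB
    rcases h ((Representation.IntertwiningMap.equivAlgEnd ρ).symm f)
      (hfi.map (Representation.IntertwiningMap.equivAlgEnd ρ).symm) with h0 | h0
    · left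
      have : f = 0 := by simpa using h0
      rw [← Submodule.range_projection hAB, ← hf, this, LinearMap.range_zero]
    · right
      have : f = 1 := by simpa using h0
      rw [← Submodule.ker_projection hAB, ← hf, this, Module.End.one_eq_id, LinearMap.ker_id]

theorem RepIso.repIndecomposable {ρ : Representation k G V} {τ : Representation k G W}
    (h : RepIso ρ τ) (hτ : RepIndecomposable τ) : RepIndecomposable ρ := by
  obtain ⟨φ⟩ := h
  obtain ⟨hn, hτ⟩ := hτ
  refine ⟨(Equiv.nontrivial_congr (α := V) (β := W) φ.toEquiv).2 hn, fun A B hAB => ?_⟩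
  have := hτ _ _ ((Submodule.orderIsoMapComap φ).isCompl hAB)
  simpa using this

/-- The easy half of Fitting's lemma: in an equivariant splitting `1 = a + (1 - a)` on an
indecomposable representation, one of the two terms is bijective. -/
theorem RepIndecomposable.bijective_or_bijective_one_sub [FiniteDimensional k V]
    {ρ : Representation k G V} (hρ : RepIndecomposable ρ) (a : Module.End k V)
    (ha : ∀ g v, a (ρ g v) = ρ g (a v)) :
    Function.Bijective a ∨ Function.Bijective (1 - a : Module.End k V) := by
  let a' : ρ.IntertwiningMap ρ := ⟨a, fun g => LinearMap.ext (ha g)⟩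
  let A := Representation.IntertwiningMap.equivAlgEnd ρ a'
  have : IsNoetherian (MonoidAlgebra k G) ρ.asModule := isNoetherian_of_tower k inferInstance
  have : IsArtinian (MonoidAlgebra k G) ρ.asModule := isArtinian_of_tower k inferInstance
  obtain ⟨n, hn, hc⟩ := ((Filter.eventually_ge_atTop 1).and
    A.eventually_isCompl_ker_pow_range_pow).exists
  rcases hρ.2 _ _ hc with h | h
  · left
    have hinj : Function.Injective (A ^ n) := LinearMap.ker_eq_bot.1 h
    have h1 : Function.Injective a := by
      obtain ⟨m, rfl⟩ := Nat.exists_eq_add_of_le' hn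
      rw [pow_succ] at hinj
      exact Function.Injective.of_comp (f := (A ^ m)) hinj
    exact ⟨h1, LinearMap.injective_iff_surjective.1 h1⟩
  · right
    have h0 : A ^ n = 0 := LinearMap.range_eq_bot.1 h
    exact (Module.End.isUnit_iff (R := MonoidAlgebra k G) (1 - A)).1
      (IsNilpotent.isUnit_one_sub ⟨n, h0⟩)

/-- `ρ` is an equivariant retract of `τ`. -/
def RepRetract (ρ : Representation k G V) (τ : Representation k G W) : Prop :=
  ∃ (i : V →ₗ[k] W) (q : W →ₗ[k] V), (∀ g v, i (ρ g v) = τ g (i v)) ∧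
    (∀ g w, q (τ g w) = ρ g (q w)) ∧ ∀ v, q (i v) = v

theorem RepRetract.of_bijective {ρ : Representation k G V} {τ : Representation k G W}
    (i : V →ₗ[k] W) (q : W →ₗ[k] V) (hi : ∀ g v, i (ρ g v) = τ g (i v))
    (hq : ∀ g w, q (τ g w) = ρ g (q w)) (h : Function.Bijective (q ∘ₗ i)) :
    RepRetract ρ τ := by
  let u := LinearEquiv.ofBijective (q ∘ₗ i) h
  refine ⟨i, u.symm.toLinearMap ∘ₗ q, hi, fun g w => ?_, fun v => ?_⟩
  · apply u.injective
    have : ∀ v, u (ρ g v) = ρ g (u v) := fun v => by simp [u, hi, hq]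
    simp [hq, this]
  · exact u.symm_apply_apply v

theorem RepRetract.repSummand {ρ : Representation k G V} {τ : Representation k G W}
    (h : RepRetract ρ τ) : RepSummand ρ τ := by
  obtain ⟨i, q, hi, hq, hqi⟩ := h
  let I := Representation.IntertwiningMap.equivLinearMapAsModule ρ τ
    ⟨i, fun g => LinearMap.ext (hi g)⟩
  let Q := Representation.IntertwiningMap.equivLinearMapAsModule τ ρ
    ⟨q, fun g => LinearMap.ext (hq g)⟩
  have hQI : Function.LeftInverse Q I := hqi
  refine ⟨LinearMap.range I, LinearMap.ker Q, ⟨?_, ?_⟩,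
    ⟨LinearEquiv.ofInjective I hQI.injective⟩⟩
  · rw [Submodule.disjoint_def]
    rintro _ ⟨v, rfl⟩ hv
    rw [LinearMap.mem_ker, hQI v] at hv
    rw [hv, map_zero]
  · rw [codisjoint_iff_le_sup]
    intro x _
    refine Submodule.mem_sup.2 ⟨I (Q x), ⟨_, rfl⟩, x - I (Q x), ?_, by abel⟩
    rw [LinearMap.mem_ker, map_sub, hQI, sub_self]

end Indecomposable

section BaseChange

variable {F : Type u} [Field F] {K : Type*} [Field K] [Algebra F K] {G : Type*} [Monoid G]
  {V : Type*} [AddCommGroup V] [Module K V]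

@[simp]
theorem repBaseChange_apply {W : Type*} [AddCommGroup W] [Module F W] (τ : Representation F G W)
    (g : G) : repBaseChange K τ g = (τ g).baseChange K := rfl

theorem baseChange_comm {W W' : Type*} [AddCommGroup W] [Module F W] [AddCommGroup W'] [Module F W']
    {τ : Representation F G W} {τ' : Representation F G W'} (f : W →ₗ[F] W')
    (hf : ∀ g w, f (τ g w) = τ' g (f w)) (g : G) (x : K ⊗[F] W) :
    f.baseChange K (repBaseChange K τ g x) = repBaseChange K τ' g (f.baseChange K x) := by
  induction x with
  | zero => simp
  | add x y hx hy => simp only [map_add, hx, hy]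
  | tmul a w => simp [hf]

/-- A representation whose base change is indecomposable is indecomposable. -/
theorem RepIndecomposable.of_repBaseChange {W : Type*} [AddCommGroup W] [Module F W]
    {τ : Representation F G W} (h : RepIndecomposable (repBaseChange K τ)) :
    RepIndecomposable τ := by
  rw [repIndecomposable_iff_idempotent] at h ⊢
  have hinj : ∀ f f' : W →ₗ[F] W, f.baseChange K = f'.baseChange K → f = f' := by
    intro f f' hff
    ext w
    have := congr($hff (1 ⊗ₜ w))
    simp only [LinearMap.baseChange_tmul] at this
    exact Module.FaithfullyFlat.tensorProduct_mk_injective (A := F) (B := K) W this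
  refine ⟨?_, fun e he => ?_⟩
  · by_contra hW
    rw [not_nontrivial_iff_subsingleton] at hW
    have := h.1
    exact not_subsingleton (K ⊗[F] W) inferInstance
  · have := h.2 ⟨e.toLinearMap.baseChange K, fun g => LinearMap.ext
      (baseChange_comm e.toLinearMap e.isIntertwining g)⟩ (by
        apply Representation.IntertwiningMap.toLinearMap_injective
        have h2 : e.toLinearMap ∘ₗ e.toLinearMap = e.toLinearMap := congr(($he).toLinearMap)
        change e.toLinearMap.baseChange K ∘ₗ e.toLinearMap.baseChange K = _
        rw [← LinearMap.baseChange_comp, h2])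
    refine this.imp (fun h0 => ?_) (fun h1 => ?_)
    · apply Representation.IntertwiningMap.toLinearMap_injective
      apply hinj
      have := congr(($h0).toLinearMap)
      simpa using this
    · apply Representation.IntertwiningMap.toLinearMap_injective
      apply hinj
      have := congr(($h1).toLinearMap)
      refine this.trans ?_
      exact LinearMap.baseChange_id.symm

/-- If `ρ` is a retract of the base change of `τ`, and the component of the retraction through
an equivariant endomorphism `e` is bijective, then `ρ` is a retract of the base change of the
range of `e`. -/
theorem exists_repRetract_range {W : Type*} [AddCommGroup W] [Module F W]
    {ρ : Representation K G V} {τ : Representation F G W}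
    (i : V →ₗ[K] K ⊗[F] W) (q : K ⊗[F] W →ₗ[K] V)
    (hi : ∀ g v, i (ρ g v) = repBaseChange K τ g (i v))
    (hq : ∀ g w, q (repBaseChange K τ g w) = ρ g (q w)) (e : τ.IntertwiningMap τ)
    (h : Function.Bijective (q ∘ₗ e.toLinearMap.baseChange K ∘ₗ i)) :
    RepRetract ρ (repBaseChange K e.range.toRepresentation) := by
  let s : e.range.toSubmodule →ₗ[F] W := e.range.toSubmodule.subtype
  let r : W →ₗ[F] e.range.toSubmodule := e.toLinearMap.rangeRestrict
  have hr : ∀ g w, r (τ g w) = e.range.toRepresentation g (r w) :=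
    fun g w => Subtype.ext (Representation.IntertwiningMap.isIntertwining τ τ e g w)
  have hs : ∀ g w, s (e.range.toRepresentation g w) = τ g (s w) := fun g w => rfl
  refine RepRetract.of_bijective (r.baseChange K ∘ₗ i) (q ∘ₗ s.baseChange K) (fun g v => ?_)
    (fun g w => ?_) ?_
  · rw [LinearMap.comp_apply, hi, baseChange_comm r hr, LinearMap.comp_apply]
  · rw [LinearMap.comp_apply, baseChange_comm s hs, hq, LinearMap.comp_apply]
  · have hsr : s ∘ₗ r = e.toLinearMap := rfl
    rwa [LinearMap.comp_assoc, ← LinearMap.comp_assoc i, ← LinearMap.baseChange_comp, hsr]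

/-- An indecomposable retract of a base change is a retract of the base change of an
indecomposable representation. -/
theorem exists_repIndecomposable_repRetract [FiniteDimensional K V] {ρ : Representation K G V}
    (hρ : RepIndecomposable ρ) {W : Type u} [AddCommGroup W] [Module F W] [FiniteDimensional F W]
    (τ : Representation F G W) (h : RepRetract ρ (repBaseChange K τ)) :
    ∃ W' : FDRep F G, RepIndecomposable W'.ρ ∧ RepRetract ρ (repBaseChange K W'.ρ) := by
  generalize hn : Module.finrank F W = n
  induction n using Nat.strong_induction_on generalizing W with
  | _ n ih =>
  by_cases hW : RepIndecomposable τ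
  · exact ⟨FDRep.of τ, hW, h⟩
  obtain ⟨i, q, hi, hq, hqi⟩ := h
  have hnt : Nontrivial W := by
    by_contra hW
    rw [not_nontrivial_iff_subsingleton] at hW
    have := hρ.1
    have : Function.Injective i := Function.LeftInverse.injective hqi
    exact not_subsingleton V this.subsingleton
  have step : ∀ e : τ.IntertwiningMap τ, IsIdempotentElem e → e ≠ 1 →
      Function.Bijective (q ∘ₗ e.toLinearMap.baseChange K ∘ₗ i) →
      ∃ W' : FDRep F G, RepIndecomposable W'.ρ ∧ RepRetract ρ (repBaseChange K W'.ρ) := by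
    intro e he he1 hb
    have hlt : Module.finrank F (LinearMap.range e.toLinearMap) < n := by
      rw [← hn]
      refine Submodule.finrank_lt fun htop => he1 ?_
      ext w
      obtain ⟨w', rfl⟩ := LinearMap.range_eq_top.1 htop w
      exact congr($he w')
    exact ih _ hlt _ (exists_repRetract_range i q hi hq e hb) rfl
  rw [repIndecomposable_iff_idempotent] at hW
  push Not at hW
  obtain ⟨e, he, he0, he1⟩ := hW hnt
  have hcomm := baseChange_comm (K := K) e.toLinearMap
    (Representation.IntertwiningMap.isIntertwining τ τ e)
  rcases hρ.bijective_or_bijective_one_sub (q ∘ₗ e.toLinearMap.baseChange K ∘ₗ i)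
    (fun g v => by simp only [LinearMap.comp_apply, hi, hcomm, hq]) with hb | hb
  · exact step e he he1 hb
  · let e' : τ.IntertwiningMap τ :=
      ⟨LinearMap.id - e.toLinearMap, fun g => by
        rw [LinearMap.sub_comp, LinearMap.comp_sub, e.isIntertwining']; rfl⟩
    have hee : e.toLinearMap ∘ₗ e.toLinearMap = e.toLinearMap := congr(($he).toLinearMap)
    refine step e' ?_ (fun h => he0 ?_) ?_
    · apply Representation.IntertwiningMap.toLinearMap_injective
      change (LinearMap.id - e.toLinearMap) ∘ₗ (LinearMap.id - e.toLinearMap) =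
        LinearMap.id - e.toLinearMap
      rw [LinearMap.sub_comp, LinearMap.comp_sub, LinearMap.comp_sub, hee]
      simp
    · apply Representation.IntertwiningMap.toLinearMap_injective
      have h1 : LinearMap.id - e.toLinearMap = LinearMap.id := congr(($h).toLinearMap)
      exact sub_eq_self.1 h1
    · have : q ∘ₗ e'.toLinearMap.baseChange K ∘ₗ i =
          1 - q ∘ₗ e.toLinearMap.baseChange K ∘ₗ i := by
        ext v
        simp [e', LinearMap.baseChange_sub, hqi]
      rwa [this]

/-- A representation over a finite separable extension `K` of `F` is a retract of the base change
of its restriction of scalars to `F`. -/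
theorem repRetract_repBaseChange_repRes [FiniteDimensional F K] [Algebra.IsSeparable F K]
    [Module F V] [IsScalarTower F K V] (ρ : Representation K G V) :
    RepRetract ρ (repBaseChange K (repRes F ρ)) := by
  have : Algebra.FormallyUnramified F K := Algebra.FormallyUnramified.of_isSeparable F K
  refine ⟨Algebra.FormallyUnramified.sec F K V,
    TensorProduct.AlgebraTensorModule.lift
    ((Algebra.lsmul K K V).toLinearMap.flip.restrictScalars F).flip, fun g v => ?_,
    fun g w => ?_, fun v => ?_⟩
  · simp only [Algebra.FormallyUnramified.sec]
    dsimp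
    induction Algebra.FormallyUnramified.elem F K with
    | zero => simp
    | add x y hx hy => simp only [map_add, hx, hy]
    | tmul a c => simp [repRes]
  · induction w with
    | zero => simp
    | add x y hx hy => simp only [map_add, hx, hy]
    | tmul a w => simp [repRes]
  · exact congr($(Algebra.FormallyUnramified.comp_sec F K V) v)

end BaseChange

section Descent

/-- A finite-dimensional representation over an algebraic extension of `F` is defined over a
finite subextension. -/
theorem exists_finiteDimensional_repIso {F : Type*} {L : Type*} [Field F] [Field L] [Algebra F L]
    [Algebra.IsAlgebraic F L] {G : Type*} [Monoid G] [Finite G] {Y : Type*} [AddCommGroup Y]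
    [Module L Y] [FiniteDimensional L Y] (σ : Representation L G Y) :
    ∃ K : IntermediateField F L, FiniteDimensional F K ∧
      ∃ ρ : Representation K G (Fin (Module.finrank L Y) → K), RepIso (repBaseChange L ρ) σ := by
  classical
  let b := Module.finBasis L Y
  let S : Set L := Set.range fun x : G × Fin _ × Fin _ =>
    LinearMap.toMatrix b b (σ x.1) x.2.1 x.2.2
  let K := IntermediateField.adjoin F S
  have hmem : ∀ g i j, LinearMap.toMatrix b b (σ g) i j ∈ K :=
    fun g i j => IntermediateField.subset_adjoin F S ⟨(g, i, j), rfl⟩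
  let M : G → Matrix (Fin _) (Fin _) K := fun g i j => ⟨_, hmem g i j⟩
  have hM : ∀ g, (algebraMap K L).mapMatrix (M g) = LinearMap.toMatrix b b (σ g) := fun g => rfl
  have hinj : Function.Injective
      ((algebraMap K L).mapMatrix : Matrix (Fin (Module.finrank L Y)) _ K → _) :=
    Matrix.map_injective (algebraMap K L).injective
  let ρ : Representation K G (Fin (Module.finrank L Y) → K) :=
    { toFun g := Matrix.toLin' (M g)
      map_one' := by
        rw [show M 1 = 1 from hinj (by rw [hM, map_one σ, Module.End.one_eq_id, LinearMap.toMatrix_id, map_one])]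
        exact Matrix.toLin'_one
      map_mul' g h := by
        rw [show M (g * h) = M g * M h from
          hinj (by rw [map_mul, hM, hM, hM, map_mul, LinearMap.toMatrix_mul])]
        exact Matrix.toLin'_mul _ _ }
  let φ : L ⊗[K] (Fin (Module.finrank L Y) → K) ≃ₗ[L] Y :=
    ((Pi.basisFun K (Fin (Module.finrank L Y))).baseChange L).equiv b (.refl _)
  have hφ : ∀ j, φ (1 ⊗ₜ Pi.single j 1) = b j := by
    intro j
    have := ((Pi.basisFun K (Fin (Module.finrank L Y))).baseChange L).equiv_apply j b (.refl _)
    simpa using this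
  refine ⟨K, IntermediateField.finiteDimensional_adjoin
    fun x _ => Algebra.IsIntegral.isIntegral x, ρ, ?_⟩
  have hcomm : ∀ g, φ.toLinearMap ∘ₗ repBaseChange L ρ g = σ g ∘ₗ φ.toLinearMap := by
    intro g
    apply ((Pi.basisFun K (Fin (Module.finrank L Y))).baseChange L).ext
    intro j
    have h1 : ρ g (Pi.single j 1) = ∑ i, M g i j • Pi.single i (1 : K) := by
      ext i
      simp [ρ, Matrix.toLin'_apply, Pi.single_apply]
    simp only [Module.Basis.baseChange_apply, Pi.basisFun_apply, LinearMap.comp_apply,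
      LinearEquiv.coe_coe, repBaseChange_apply, LinearMap.baseChange_tmul, h1, hφ]
    rw [TensorProduct.tmul_sum, map_sum, ← b.sum_repr (σ g (b j))]
    refine Finset.sum_congr rfl fun i _ => ?_
    rw [← LinearMap.toMatrix_apply, TensorProduct.tmul_smul, ← hφ, ← map_smul]
    rfl
  let Φ := Representation.IntertwiningMap.equivLinearMapAsModule _ _
    (⟨φ.toLinearMap, hcomm⟩ : (repBaseChange L ρ).IntertwiningMap σ)
  exact ⟨LinearEquiv.ofBijective Φ φ.bijective⟩

end Descent

/-- Totality of the map `Γ : ITI(F̄G) → ITI(FG)` : every finite-dimensional indecomposable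
`F̄G`-module `Y` arises as `V ⊗_K F̄` for a finite subfield `K` of `F̄` and an indecomposable
`KG`-module `V` which is a component of `W ⊗_F K` for some indecomposable `FG`-module `W`. -/
theorem gamma_total (p : ℕ) [Fact p.Prime]
    (G : Type) [Group G] [Finite G]
    (Y : FDRep (AlgebraicClosure (ZMod p)) G) (hY : RepIndecomposable Y.ρ) :
    ∃ K : IntermediateField (ZMod p) (AlgebraicClosure (ZMod p)), Finite ↥K ∧
      ∃ W : FDRep (ZMod p) G, RepIndecomposable W.ρ ∧
        ∃ V : FDRep ↥K G, RepIndecomposable V.ρ ∧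
          RepSummand V.ρ (repBaseChange ↥K W.ρ) ∧
          RepIso (repBaseChange (AlgebraicClosure (ZMod p)) V.ρ) Y.ρ := by
  obtain ⟨K, hK, ρ, hρ⟩ := exists_finiteDimensional_repIso (F := ZMod p) Y.ρ
  have hV : RepIndecomposable ρ := (hρ.repIndecomposable hY).of_repBaseChange
  obtain ⟨W, hW, hWV⟩ := exists_repIndecomposable_repRetract hV (repRes (ZMod p) ρ)
    (repRetract_repBaseChange_repRes ρ)
  exact ⟨K, Module.finite_of_finite (ZMod p), W, hW, FDRep.of ρ, hV, hWV.repSummand, hρ⟩
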